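/- Suppose that (X, d_X) and (Y, d_Y) are two metric spaces, f : X → Y is a Borel measurable map with distortion dis(f) ≤ ε, and μ and ν are two Borel probability measures on X. Then the Prohorov distance satisfies d_P(f_*μ, f_*ν) ≤ d_P(μ, ν) + ε. -/

import Mathlib

open MeasureTheory Metric Set

/-- `dis(f) ≤ ε`: the distortion of `f` is at most `ε`. -/
def DistortionLE {X Y : Type*} [MetricSpace X] [MetricSpace Y] (f : X → Y) (ε : ℝ) : Prop :=
  ∀ x₁ x₂ : X, |dist x₁ x₂ - dist (f x₁) (f x₂)| ≤ ε

/-- The Prohorov distance between two Borel measures: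
`inf {ε > 0 : μ(C) ≤ ν(C^ε) + ε for all closed C}`, where `C^ε` is the open
`ε`-thickening of `C`. -/
noncomputable def prohorovDist {X : Type*} [MetricSpace X] [MeasurableSpace X]
    (μ ν : Measure X) : ℝ :=
  sInf {ε : ℝ | 0 < ε ∧ ∀ C : Set X, IsClosed C →
    μ C ≤ ν (Metric.thickening ε C) + ENNReal.ofReal ε}

/-- Pushing forward two probability measures by a measurable map of distortion at most `ε`
increases their Prohorov distance by at most `ε`. -/
theorem prohorovDist_map_le
    (X Y : Type*) [MetricSpace X] [MeasurableSpace X] [BorelSpace X]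
    [MetricSpace Y] [MeasurableSpace Y] [BorelSpace Y]
    (f : X → Y) (hf : Measurable f) (ε : ℝ) (hdis : DistortionLE f ε)
    (μ ν : Measure X) [IsProbabilityMeasure μ] [IsProbabilityMeasure ν] :
    prohorovDist (μ.map f) (ν.map f) ≤ prohorovDist μ ν + ε := by
  obtain ⟨x₀⟩ : Nonempty X := nonempty_of_isProbabilityMeasure μ
  have hε : 0 ≤ ε := (abs_nonneg _).trans (hdis x₀ x₀)
  have key : prohorovDist (μ.map f) (ν.map f) - ε ≤ prohorovDist μ ν := by
    unfold prohorovDist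
    refine le_csInf ⟨1, one_pos, fun C _ => ?_⟩ ?_
    · calc μ C ≤ 1 := prob_le_one
        _ = ENNReal.ofReal 1 := by simp
        _ ≤ _ := le_add_self
    · rintro δ ⟨hδ, h⟩
      rw [sub_le_iff_le_add]
      refine csInf_le ⟨0, fun r hr => hr.1.le⟩ ⟨by linarith, fun C hC => ?_⟩
      rw [Measure.map_apply hf hC.measurableSet,
        Measure.map_apply hf isOpen_thickening.measurableSet]
      have h1 := h (closure (f ⁻¹' C)) isClosed_closure
      rw [thickening_closure] at h1
      refine (measure_mono subset_closure).trans (h1.trans ?_)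
      refine add_le_add (measure_mono fun x hx => ?_) (ENNReal.ofReal_le_ofReal (by linarith))
      obtain ⟨z, hz, hxz⟩ := mem_thickening_iff.1 hx
      refine mem_thickening_iff.2 ⟨f z, hz, ?_⟩
      have := (abs_le.1 (hdis x z)).1
      linarith
  linarith
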